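/- Let X and Z be independent ℝ^d-valued random vectors, let ‖·‖ be a norm on ℝ^d and r > 0, and assume E[‖Z‖^r] < ∞. If H(⌊X⌋) = ∞, then H(⌊X + εZ⌋) = ∞ for every ε > 0. -/

import Mathlib

open MeasureTheory ProbabilityTheory Real Filter Topology
open scoped ENNReal

/-- Componentwise integer part of a vector in ℝ^d. -/
noncomputable def intFloor (d : ℕ) (x : Fin d → ℝ) : Fin d → ℤ := fun i => ⌊x i⌋

/-- Discrete (Shannon) entropy, in nats, of the random element `V` under `P`,
valued in `[0,∞]`. -/
noncomputable def discEnt {Ω α : Type*} [MeasurableSpace Ω] (P : Measure Ω) (V : Ω → α) : ℝ≥0∞ :=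
  ∑' a : α, ENNReal.ofReal (Real.negMulLog (P (V ⁻¹' {a})).toReal)

/-- Differential entropy of a measure on ℝ^d (w.r.t. Lebesgue measure),
as a Bochner integral of `-f log f` where `f` is the Radon–Nikodym density. -/
noncomputable def diffEnt {d : ℕ} (μ : Measure (Fin d → ℝ)) : ℝ :=
  -∫ x, ((μ.rnDeriv volume x).toReal) * Real.log ((μ.rnDeriv volume x).toReal)

open Classical in
/-- Kullback–Leibler divergence of `μ` w.r.t. `ν`, valued in `[0,∞]`. -/
noncomputable def klDiv {α : Type*} [MeasurableSpace α] (μ ν : Measure α) : ℝ≥0∞ :=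
  if μ ≪ ν ∧ Integrable (llr μ ν) μ then ENNReal.ofReal (∫ x, llr μ ν x ∂μ) else ⊤

/-- Gibbs' inequality at a single atom. -/
lemma negMulLog_le_mul_neg_log_add {a b : ℝ} (ha : 0 < a) (hb : 0 < b) :
    negMulLog a ≤ a * -log b + b := by
  have h := Real.log_le_sub_one_of_pos (div_pos hb ha)
  rw [Real.log_div hb.ne' ha.ne'] at h
  have h2 := mul_le_mul_of_nonneg_left h ha.le
  have h3 : a * (b / a - 1) = b - a := by field_simp
  rw [h3] at h2
  simp only [negMulLog]
  linarith

lemma ofReal_negMulLog_toReal {x : ℝ≥0∞} (hx : x ≠ ⊤) :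
    ENNReal.ofReal (negMulLog x.toReal) = x * ENNReal.ofReal (-log x.toReal) := by
  rw [negMulLog, neg_mul_comm, ENNReal.ofReal_mul ENNReal.toReal_nonneg, ENNReal.ofReal_toReal hx]

lemma mul_ofReal_neg_log_le {p A q : ℝ≥0∞} (hpA : p ≤ A) (hpq : p ≤ q) (hA : A ≤ 1) (hq : q ≤ 1)
    {c : ℝ} (hc : 0 < c) (hc1 : c ≤ 1) :
    p * ENNReal.ofReal (-log A.toReal) ≤ p * ENNReal.ofReal (-log q.toReal)
      + p * ENNReal.ofReal (-log c) + q * ENNReal.ofReal c := by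
  rcases eq_or_ne p 0 with rfl | hp
  · simp
  have hA' : A ≠ ⊤ := ne_top_of_le_ne_top ENNReal.one_ne_top hA
  have hq' : q ≠ ⊤ := ne_top_of_le_ne_top ENNReal.one_ne_top hq
  have hp' : p ≠ ⊤ := ne_top_of_le_ne_top hA' hpA
  lift p to NNReal using hp'
  lift A to NNReal using hA'
  lift q to NNReal using hq'
  have hp0 : (0 : ℝ) < p := by
    have : p ≠ 0 := by simpa using hp
    positivity
  have hpA' : (p : ℝ) ≤ A := by exact_mod_cast hpA
  have hpq' : (p : ℝ) ≤ q := by exact_mod_cast hpq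
  have hq1 : (q : ℝ) ≤ 1 := by exact_mod_cast hq
  have hq0 : (0 : ℝ) < q := hp0.trans_le hpq'
  have hlq : 0 ≤ -log (q : ℝ) := by simpa using Real.log_nonpos hq0.le hq1
  have hlc : 0 ≤ -log c := by simpa using Real.log_nonpos hc.le hc1
  have key := negMulLog_le_mul_neg_log_add hp0 (mul_pos hq0 hc)
  rw [Real.log_mul hq0.ne' hc.ne', negMulLog] at key
  have hlog := mul_le_mul_of_nonneg_left (Real.log_le_log hp0 hpA') hp0.le
  simp only [ENNReal.coe_toReal]
  rw [← ENNReal.ofReal_coe_nnreal (p := p), ← ENNReal.ofReal_coe_nnreal (p := q),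
    ← ENNReal.ofReal_mul hp0.le, ← ENNReal.ofReal_mul hp0.le, ← ENNReal.ofReal_mul hp0.le,
    ← ENNReal.ofReal_mul hq0.le, ← ENNReal.ofReal_add (by positivity) (by positivity),
    ← ENNReal.ofReal_add (by positivity) (by positivity)]
  exact ENNReal.ofReal_le_ofReal (by linarith)

lemma measure_preimage_eq_tsum_inter {Ω α : Type*} [MeasurableSpace Ω] [MeasurableSpace α]
    [Countable α] [MeasurableSingletonClass α] (P : Measure Ω) {V : Ω → α} (hV : Measurable V)
    (s : Set Ω) : P s = ∑' v, P (s ∩ V ⁻¹' {v}) := by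
  have h := tsum_measure_preimage_singleton (μ := P.restrict s) (Set.countable_univ) (f := V)
    (fun y _ => hV (measurableSet_singleton y))
  rw [tsum_univ (fun y => P.restrict s (V ⁻¹' {y}))] at h
  simp only [Measure.restrict_apply (hV (measurableSet_singleton _)), Set.preimage_univ,
    Measure.restrict_apply_univ] at h
  rw [← h]
  simp only [Set.inter_comm]

/-- The entropy of `U` is at most that of `V` plus the cost of coding the difference `U - V`
with the sub-probability weights proportional to `c`. -/
lemma discEnt_le_add_lintegral {Ω G : Type*} [MeasurableSpace Ω] [AddCommGroup G]
    [MeasurableSpace G] [Countable G] [MeasurableSingletonClass G]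
    (P : Measure Ω) [IsProbabilityMeasure P] {U V : Ω → G} (hU : Measurable U) (hV : Measurable V)
    {c : G → ℝ} (hc : ∀ k, 0 < c k) (hc1 : ∀ k, c k ≤ 1) :
    discEnt P U ≤ discEnt P V + ∫⁻ ω, ENNReal.ofReal (-log (c (U ω - V ω))) ∂P
      + ∑' k, ENNReal.ofReal (c k) := by
  set p : G → G → ℝ≥0∞ := fun u v => P (U ⁻¹' {u} ∩ V ⁻¹' {v}) with hp
  have hPU : ∀ u, P (U ⁻¹' {u}) = ∑' v, p u v := fun u => measure_preimage_eq_tsum_inter P hV _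
  have hPV : ∀ v, P (V ⁻¹' {v}) = ∑' u, p u v := fun v => by
    rw [measure_preimage_eq_tsum_inter P hU]
    simp only [hp, Set.inter_comm]
  have hint : ∫⁻ ω, ENNReal.ofReal (-log (c (U ω - V ω))) ∂P
      = ∑' u, ∑' v, p u v * ENNReal.ofReal (-log (c (u - v))) := by
    rw [← lintegral_map (μ := P) (f := fun x : G × G => ENNReal.ofReal (-log (c (x.1 - x.2))))
      (measurable_of_countable _) (hU.prodMk hV), lintegral_countable', ENNReal.tsum_prod']
    refine tsum_congr fun u => tsum_congr fun v => ?_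
    rw [Measure.map_apply (hU.prodMk hV) (measurableSet_singleton _), mul_comm,
      ← Set.singleton_prod_singleton, Set.mk_preimage_prod]
  have hent : discEnt P V
      = ∑' u, ∑' v, p u v * ENNReal.ofReal (-log (P (V ⁻¹' {v})).toReal) := by
    rw [ENNReal.tsum_comm, discEnt]
    refine tsum_congr fun v => ?_
    rw [ENNReal.tsum_mul_right, ← hPV, ofReal_negMulLog_toReal (measure_ne_top _ _)]
  have hsum : ∑' k, ENNReal.ofReal (c k)
      = ∑' u, ∑' v, P (V ⁻¹' {v}) * ENNReal.ofReal (c (u - v)) := by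
    rw [ENNReal.tsum_comm]
    have h : ∀ v, ∑' u, P (V ⁻¹' {v}) * ENNReal.ofReal (c (u - v))
        = P (V ⁻¹' {v}) * ∑' k, ENNReal.ofReal (c k) := fun v => by
      rw [ENNReal.tsum_mul_left,
        ← (Equiv.subRight v).tsum_eq (fun k => ENNReal.ofReal (c k))]
      rfl
    have hone := measure_preimage_eq_tsum_inter P hV Set.univ
    simp only [measure_univ, Set.univ_inter] at hone
    rw [tsum_congr h, ENNReal.tsum_mul_right, ← hone, one_mul]
  rw [hint, hent, hsum, ← ENNReal.tsum_add, ← ENNReal.tsum_add]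
  refine ENNReal.tsum_le_tsum fun u => ?_
  rw [← ENNReal.tsum_add, ← ENNReal.tsum_add, ofReal_negMulLog_toReal (measure_ne_top _ _)]
  nth_rewrite 1 [hPU u]
  rw [← ENNReal.tsum_mul_right]
  exact ENNReal.tsum_le_tsum fun v => mul_ofReal_neg_log_le
    (measure_mono Set.inter_subset_left) (measure_mono Set.inter_subset_right)
    prob_le_one prob_le_one (hc _) (hc1 _)

lemma ENNReal.tsum_pi_fin_prod {α : Type*} (f : α → ℝ≥0∞) (d : ℕ) :
    ∑' k : Fin d → α, ∏ i, f (k i) = (∑' n, f n) ^ d := by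
  induction d with
  | zero => simp
  | succ d ih =>
    rw [← (Fin.consEquiv fun _ : Fin (d + 1) => α).tsum_eq, ENNReal.tsum_prod', pow_succ']
    simp only [Fin.consEquiv_apply, Fin.prod_univ_succ, Fin.cons_zero, Fin.cons_succ,
      ENNReal.tsum_mul_left, ih, ENNReal.tsum_mul_right]

lemma summable_inv_one_add_abs_sq : Summable fun n : ℤ => ((1 + |(n : ℝ)|) ^ 2)⁻¹ := by
  refine Summable.of_nat_of_neg ?_ ?_ <;>
  · simp only [Int.cast_neg, abs_neg, Int.cast_natCast, Nat.abs_cast]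
    have h := (summable_nat_add_iff 1).2 (Real.summable_nat_pow_inv.2 (one_lt_two))
    refine h.congr fun n => ?_
    push_cast
    rw [add_comm]

lemma tsum_ofReal_prod_inv_one_add_abs_sq_ne_top (d : ℕ) :
    ∑' k : Fin d → ℤ, ENNReal.ofReal (∏ i, ((1 + |(k i : ℝ)|) ^ 2)⁻¹) ≠ ⊤ := by
  have h : ∀ k : Fin d → ℤ, ENNReal.ofReal (∏ i, ((1 + |(k i : ℝ)|) ^ 2)⁻¹)
      = ∏ i, ENNReal.ofReal ((1 + |(k i : ℝ)|) ^ 2)⁻¹ := fun k =>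
    ENNReal.ofReal_prod_of_nonneg fun i _ => by positivity
  rw [tsum_congr h,
    ENNReal.tsum_pi_fin_prod fun n : ℤ => ENNReal.ofReal ((1 + |(n : ℝ)|) ^ 2)⁻¹]
  exact ENNReal.pow_ne_top summable_inv_one_add_abs_sq.tsum_ofReal_ne_top

lemma neg_log_prod_inv_one_add_abs_sq_le {d : ℕ} (k : Fin d → ℤ) {B r : ℝ} (hr : 0 < r)
    (hB : 0 ≤ B) (hk : ∀ i, 1 + |(k i : ℝ)| ≤ B) :
    -log (∏ i, ((1 + |(k i : ℝ)|) ^ 2)⁻¹) ≤ d * (2 / r) * B ^ r := by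
  rw [Real.log_prod (fun i _ => by positivity), ← Finset.sum_neg_distrib]
  have h : ∀ i ∈ Finset.univ, -log (((1 + |(k i : ℝ)|) ^ 2)⁻¹) ≤ 2 / r * B ^ r := fun i _ => by
    rw [Real.log_inv, Real.log_pow, neg_neg]
    have h1 := (Real.log_le_log (by positivity) (hk i)).trans (Real.log_le_rpow_div hB hr)
    calc _ ≤ 2 * (B ^ r / r) := by push_cast; linarith
      _ = _ := by ring
  calc _ ≤ ∑ i : Fin d, 2 / r * B ^ r := Finset.sum_le_sum h
    _ = _ := by simp [mul_assoc]

/-- A continuous definite seminorm on a finite-dimensional space dominates the norm. -/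
lemma Seminorm.exists_norm_le_mul {E : Type*} [NormedAddCommGroup E] [NormedSpace ℝ E]
    [FiniteDimensional ℝ E] (ν : Seminorm ℝ E) (hdef : ∀ x, ν x = 0 → x = 0)
    (hcont : Continuous ν) : ∃ K : ℝ, ∀ x, ‖x‖ ≤ K * ν x := by
  have : ProperSpace E := FiniteDimensional.proper ℝ E
  rcases subsingleton_or_nontrivial E with h | h
  · exact ⟨1, fun x => by simp [Subsingleton.elim x 0]⟩
  obtain ⟨x₀, hx₀, hmin⟩ := (isCompact_sphere (0 : E) 1).exists_isMinOn
    (NormedSpace.sphere_nonempty.2 zero_le_one) hcont.continuousOn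
  have hx₀' : 0 < ν x₀ := (apply_nonneg ν x₀).lt_of_ne fun h0 => by
    have := hdef x₀ h0.symm
    simp [this] at hx₀
  refine ⟨(ν x₀)⁻¹, fun x => ?_⟩
  rcases eq_or_ne x 0 with rfl | hx
  · simp
  have hxn : 0 < ‖x‖ := norm_pos_iff.2 hx
  have hle : ν x₀ ≤ ν (‖x‖⁻¹ • x) := hmin (by simp [norm_smul, hxn.ne'])
  rw [map_smul_eq_mul, norm_inv, norm_norm, inv_mul_eq_div, le_div_iff₀ hxn] at hle
  rw [inv_mul_eq_div, le_div_iff₀ hx₀']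
  linarith

lemma measurable_intFloor (d : ℕ) : Measurable (intFloor d) :=
  measurable_pi_lambda _ fun i => (measurable_pi_apply i).floor

lemma abs_floor_sub_floor_add_le (a b : ℝ) : |((⌊a⌋ - ⌊a + b⌋ : ℤ) : ℝ)| ≤ 1 + |b| := by
  have h1 := Int.floor_le a
  have h2 := Int.lt_floor_add_one a
  have h3 := Int.floor_le (a + b)
  have h4 := Int.lt_floor_add_one (a + b)
  push_cast
  rw [abs_le]
  constructor <;> linarith [le_abs_self b, neg_abs_le b]

lemma integrable_two_add_mul_norm_rpow {Ω E : Type*} [MeasurableSpace Ω] (P : Measure Ω)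
    [IsFiniteMeasure P] [NormedAddCommGroup E] {Z : Ω → E} {r : ℝ} (hr : 0 < r)
    (hZ : AEStronglyMeasurable Z P) {g : Ω → ℝ} (hg : AEStronglyMeasurable g P)
    (hg0 : ∀ ω, 0 ≤ g ω) (hint : Integrable (fun ω => g ω ^ r) P) {K : ℝ}
    (hle : ∀ ω, ‖Z ω‖ ≤ K * g ω) {ε : ℝ} (hε : 0 < ε) :
    Integrable (fun ω => (2 + ε * ‖Z ω‖) ^ r) P := by
  have hr0 : ENNReal.ofReal r ≠ 0 := by simpa using hr
  have hgL : MemLp g (ENNReal.ofReal r) P := by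
    rw [← integrable_norm_rpow_iff hg hr0 ENNReal.ofReal_ne_top, ENNReal.toReal_ofReal hr.le]
    exact hint.congr (.of_forall fun ω => by simp [abs_of_nonneg (hg0 ω)])
  have hZL : MemLp Z (ENNReal.ofReal r) P := (hgL.const_mul K).mono hZ (.of_forall fun ω =>
    (hle ω).trans (le_abs_self _))
  have h := ((memLp_const (2 : ℝ)).add (hZL.norm.const_mul ε)).integrable_norm_rpow hr0
    ENNReal.ofReal_ne_top
  rw [ENNReal.toReal_ofReal hr.le] at h
  refine h.congr (.of_forall fun ω => ?_)
  have h2 : 0 ≤ 2 + ε * ‖Z ω‖ := by positivity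
  simp [abs_of_nonneg h2]

/-- **Lemma 1, part (i)**: if `X` and `Z` are independent, `E[‖Z‖^r] < ∞`, and
`H(⌊X⌋) = ∞`, then `H(⌊X + εZ⌋) = ∞` for every `ε > 0`. -/
theorem floorEntropy_add_smul_eq_top
    {Ω : Type*} [MeasurableSpace Ω] (P : Measure Ω) [IsProbabilityMeasure P]
    (d : ℕ) (r : ℝ) (hr : 0 < r)
    (ν : Seminorm ℝ (Fin d → ℝ)) (hνdef : ∀ x, ν x = 0 → x = 0)
    (hνcont : Continuous fun x => ν x)
    (X Z : Ω → (Fin d → ℝ)) (hX : Measurable X) (hZ : Measurable Z)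
    (hind : IndepFun X Z P)
    (hmom : Integrable (fun ω => ν (Z ω) ^ r) P)
    (hH : discEnt P (fun ω => intFloor d (X ω)) = ⊤) :
    ∀ ε : ℝ, 0 < ε → discEnt P (fun ω => intFloor d (X ω + ε • Z ω)) = ⊤ := by
  intro ε hε
  obtain ⟨K, hKle⟩ := ν.exists_norm_le_mul hνdef hνcont
  have hint := integrable_two_add_mul_norm_rpow P hr hZ.aestronglyMeasurable
    (hνcont.measurable.comp hZ).aestronglyMeasurable (fun ω => apply_nonneg ν _) hmom
    (fun ω => hKle (Z ω)) hε
  have hle := discEnt_le_add_lintegral P ((measurable_intFloor d).comp hX)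
    ((measurable_intFloor d).comp (hX.add (hZ.const_smul ε)))
    (c := fun k : Fin d → ℤ => ∏ i, ((1 + |(k i : ℝ)|) ^ 2)⁻¹)
    (fun k => Finset.prod_pos fun i _ => by positivity)
    (fun k => Finset.prod_le_one (fun i _ => by positivity)
      fun i _ => inv_le_one_of_one_le₀ (one_le_pow₀ (by simp)))
  have hfin : ∫⁻ ω, ENNReal.ofReal (-log (∏ i, ((1 + |((intFloor d (X ω)
      - intFloor d (X ω + ε • Z ω)) i : ℝ)|) ^ 2)⁻¹)) ∂P ≠ ⊤ := by
    refine ne_top_of_le_ne_top (hint.const_mul (d * (2 / r))).lintegral_lt_top.ne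
      (lintegral_mono fun ω => ENNReal.ofReal_le_ofReal
        (neg_log_prod_inv_one_add_abs_sq_le _ hr (by positivity) fun i => ?_))
    have h1 := abs_floor_sub_floor_add_le (X ω i) (ε * Z ω i)
    have h2 : |ε * Z ω i| ≤ ε * ‖Z ω‖ := by
      rw [abs_mul, abs_of_pos hε]
      exact mul_le_mul_of_nonneg_left (norm_le_pi_norm (Z ω) i) hε.le
    simp only [intFloor, Pi.sub_apply, Pi.add_apply, Pi.smul_apply, smul_eq_mul]
    linarith
  by_contra hne
  exact ENNReal.add_ne_top.2 ⟨ENNReal.add_ne_top.2 ⟨hne, hfin⟩,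
    tsum_ofReal_prod_inv_one_add_abs_sq_ne_top d⟩ (top_le_iff.1 (hH.symm.trans_le hle))
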